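/- (CBV surface preservation.) Let t, u be CBV terms and s' a λ!-term. (1) Stability: if tᵛ →S* s' and s' is a →S,d!-normal form, then s' = sᵛ for some CBV term s. (2) Normal forms: t is a →ᵛS-normal form if and only if tᵛ is a →S-normal form. (3) Simulations: t →ᵛS* u if and only if tᵛ →S* uᵛ; moreover, the corresponding reduction sequences contain the same number of dB-steps (resp. the number of sV-steps on the CBV side equals the number of s!-steps on the λ! side). -/

import Mathlib

namespace BangPaper

/-! ### Generic rewriting notions -/

/-- `a` is a normal form for the relation `r`. -/
def IsNF {α : Type*} (r : α → α → Prop) (a : α) : Prop := ∀ b, ¬ r a b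

/-- Reflexive-transitive closure of the union of two relations,
counting the number of steps of each. -/
inductive Counted2 {α : Type*} (r₁ r₂ : α → α → Prop) : ℕ → ℕ → α → α → Prop
  | refl (t : α) : Counted2 r₁ r₂ 0 0 t t
  | step₁ {t u v : α} {m n : ℕ} :
      r₁ t u → Counted2 r₁ r₂ m n u v → Counted2 r₁ r₂ (m + 1) n t v
  | step₂ {t u v : α} {m n : ℕ} :
      r₂ t u → Counted2 r₁ r₂ m n u v → Counted2 r₁ r₂ m (n + 1) t v

/-- Reflexive-transitive closure of the union of three relations,
counting the number of steps of each. -/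
inductive Counted3 {α : Type*} (r₁ r₂ r₃ : α → α → Prop) : ℕ → ℕ → ℕ → α → α → Prop
  | refl (t : α) : Counted3 r₁ r₂ r₃ 0 0 0 t t
  | step₁ {t u v : α} {m n k : ℕ} :
      r₁ t u → Counted3 r₁ r₂ r₃ m n k u v → Counted3 r₁ r₂ r₃ (m + 1) n k t v
  | step₂ {t u v : α} {m n k : ℕ} :
      r₂ t u → Counted3 r₁ r₂ r₃ m n k u v → Counted3 r₁ r₂ r₃ m (n + 1) k t v
  | step₃ {t u v : α} {m n k : ℕ} :
      r₃ t u → Counted3 r₁ r₂ r₃ m n k u v → Counted3 r₁ r₂ r₃ m n (k + 1) t v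

/-! ### Terms of the distant Bang calculus λ! (de Bruijn representation) -/

/-- Terms of λ!: variables, application, abstraction, bang, dereliction and
explicit substitution (`sub t u` is `t[x←u]`, the binder being in `t`). -/
inductive T : Type
  | var : ℕ → T
  | app : T → T → T
  | lam : T → T
  | bang : T → T
  | der : T → T
  | sub : T → T → T

namespace T

/-- Lift (shift by one) the free de Bruijn variables `≥ k`. -/
def lift (k : ℕ) : T → T
  | var n => if n < k then var n else var (n + 1)
  | app a b => app (lift k a) (lift k b)
  | lam a => lam (lift (k + 1) a)
  | bang a => bang (lift k a)
  | der a => der (lift k a)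
  | sub a b => sub (lift (k + 1) a) (lift k b)

/-- Lift all free variables by `m` (crossing `m` binders). -/
def liftN (m : ℕ) (t : T) : T := (lift 0)^[m] t

/-- Lift all free variables except the first one by `m`
(used to push a term with one distinguished bound variable under `m` extra binders). -/
def liftUnder (m : ℕ) (t : T) : T := (lift 1)^[m] t

/-- Capture-avoiding substitution `t{k := u}` of `u` for de Bruijn variable `k`. -/
def subst : T → ℕ → T → T
  | var n, k, u => if n < k then var n else if n = k then liftN k u else var (n - 1)
  | app a b, k, u => app (subst a k u) (subst b k u)
  | lam a, k, u => lam (subst a (k + 1) u)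
  | bang a, k, u => bang (subst a k u)
  | der a, k, u => der (subst a k u)
  | sub a b, k, u => sub (subst a (k + 1) u) (subst b k u)

/-- The number of constructors (full size) of a term: it counts all
applications, abstractions, explicit substitutions, `!` and `der` occurrences. -/
def size : T → ℕ
  | var _ => 0
  | app a b => 1 + size a + size b
  | lam a => 1 + size a
  | bang a => 1 + size a
  | der a => 1 + size a
  | sub a b => 1 + size a + size b

end T

/-- Plugging a term into a list context `⟨·⟩[x₁←t₁]…[xₙ←tₙ]`
(represented as the list `[t₁, …, tₙ]`). -/
def fillL : T → List T → T
  | s, [] => s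
  | s, t :: L => fillL (T.sub s t) L

/-! ### Rewrite rules of λ! -/

/-- The names of the three rewrite rules of λ!: `dB`, `s!` and `d!`. -/
inductive Rule : Type
  | dB : Rule
  | sBang : Rule
  | dBang : Rule

/-- Root steps of the three rewrite rules of λ! (at a distance, capture-free):
`(dB)  L⟨λx.t⟩ u ↦ L⟨t[x←u]⟩`, `(s!)  t[x←L⟨!u⟩] ↦ L⟨t{x:=u}⟩`,
`(d!)  der(L⟨!t⟩) ↦ L⟨t⟩`. -/
inductive Root : Rule → T → T → Prop
  | dB (t u : T) (L : List T) :
      Root Rule.dB (T.app (fillL (T.lam t) L) u)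
        (fillL (T.sub t (T.liftN L.length u)) L)
  | sBang (t u : T) (L : List T) :
      Root Rule.sBang (T.sub t (fillL (T.bang u) L))
        (fillL (T.subst (T.liftUnder L.length t) 0 u) L)
  | dBang (t : T) (L : List T) :
      Root Rule.dBang (T.der (fillL (T.bang t) L)) (fillL t L)

/-! ### Contexts of λ! -/

/-- (Full) contexts of λ!: terms with exactly one hole, the hole may occur anywhere. -/
inductive Ctx : Type
  | hole : Ctx
  | appL : Ctx → T → Ctx
  | appR : T → Ctx → Ctx
  | lam : Ctx → Ctx
  | bang : Ctx → Ctx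
  | der : Ctx → Ctx
  | subL : Ctx → T → Ctx
  | subR : T → Ctx → Ctx

namespace Ctx

/-- Plugging a term in a context (possibly capturing its free variables). -/
def fill : Ctx → T → T
  | hole, s => s
  | appL C t, s => T.app (fill C s) t
  | appR t C, s => T.app t (fill C s)
  | lam C, s => T.lam (fill C s)
  | bang C, s => T.bang (fill C s)
  | der C, s => T.der (fill C s)
  | subL C t, s => T.sub (fill C s) t
  | subR t C, s => T.sub t (fill C s)

/-- Surface contexts: the hole does not occur under a `!`. -/
def Surface : Ctx → Prop
  | hole => True
  | appL C _ => Surface C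
  | appR _ C => Surface C
  | lam C => Surface C
  | bang _ => False
  | der C => Surface C
  | subL C _ => Surface C
  | subR _ C => Surface C

/-- Internal contexts: the full contexts that are not surface (the hole occurs under a `!`). -/
def Internal (C : Ctx) : Prop := ¬ Surface C

end Ctx

/-! ### Reductions of λ! -/

/-- `StepAt R C t u`: `t` rewrites to `u` by firing a redex of rule `R` under context `C`. -/
def StepAt (R : Rule) (C : Ctx) (t u : T) : Prop :=
  ∃ a b, Root R a b ∧ t = C.fill a ∧ u = C.fill b

/-- One step of rule `R` under some full context (`→F,R`). -/
def FStepR (R : Rule) (t u : T) : Prop := ∃ C : Ctx, StepAt R C t u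

/-- One step of rule `R` under some surface context (`→S,R`). -/
def SStepR (R : Rule) (t u : T) : Prop := ∃ C : Ctx, C.Surface ∧ StepAt R C t u

/-- One step of rule `R` under some internal context (`→I,R`). -/
def IStepR (R : Rule) (t u : T) : Prop := ∃ C : Ctx, C.Internal ∧ StepAt R C t u

/-- Full reduction `→F` of λ!. -/
def FStep (t u : T) : Prop := ∃ R, FStepR R t u

/-- Surface reduction `→S` of λ!. -/
def SStep (t u : T) : Prop := ∃ R, SStepR R t u

/-- Internal reduction `→I` of λ!. -/
def IStep (t u : T) : Prop := ∃ R, IStepR R t u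

/-- Diligent administrative surface reduction `→Sai`: `d!`-surface steps, together with
`dB`- and `s!`-surface steps whose source is a `→S,d!`-normal form. -/
def SaiStep (t u : T) : Prop :=
  SStepR Rule.dBang t u ∨
    ((SStepR Rule.dB t u ∨ SStepR Rule.sBang t u) ∧ IsNF (SStepR Rule.dBang) t)

/-- Diligent administrative full reduction `→Fai`: `d!`-full steps, together with
`dB`- and `s!`-full steps whose source is a `→F,d!`-normal form. -/
def FaiStep (t u : T) : Prop :=
  FStepR Rule.dBang t u ∨
    ((FStepR Rule.dB t u ∨ FStepR Rule.sBang t u) ∧ IsNF (FStepR Rule.dBang) t)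

/-! ### Terms of the CBN / CBV calculi (shared syntax, de Bruijn) -/

/-- Terms of the CBN/CBV calculi: variables, application, abstraction and
explicit substitution (no `!`, no `der`). -/
inductive LT : Type
  | var : ℕ → LT
  | app : LT → LT → LT
  | lam : LT → LT
  | sub : LT → LT → LT

namespace LT

/-- Lift (shift by one) the free de Bruijn variables `≥ k`. -/
def lift (k : ℕ) : LT → LT
  | var n => if n < k then var n else var (n + 1)
  | app a b => app (lift k a) (lift k b)
  | lam a => lam (lift (k + 1) a)
  | sub a b => sub (lift (k + 1) a) (lift k b)

/-- Lift all free variables by `m`. -/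
def liftN (m : ℕ) (t : LT) : LT := (lift 0)^[m] t

/-- Lift all free variables except the first one by `m`. -/
def liftUnder (m : ℕ) (t : LT) : LT := (lift 1)^[m] t

/-- Capture-avoiding substitution `t{k := u}`. -/
def subst : LT → ℕ → LT → LT
  | var n, k, u => if n < k then var n else if n = k then liftN k u else var (n - 1)
  | app a b, k, u => app (subst a k u) (subst b k u)
  | lam a, k, u => lam (subst a (k + 1) u)
  | sub a b, k, u => sub (subst a (k + 1) u) (subst b k u)

/-- Values: variables and abstractions. -/
def IsValue : LT → Prop
  | var _ => True
  | lam _ => True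
  | _ => False

end LT

/-- Plugging a CBN/CBV term into a list context. -/
def fillLN : LT → List LT → LT
  | s, [] => s
  | s, t :: L => fillLN (LT.sub s t) L

/-- The names of the CBN rewrite rules: `dB` and `s`. -/
inductive NRule : Type
  | dB : NRule
  | s : NRule

/-- Root steps of the CBN rules:
`(dB) L⟨λx.t⟩ u ↦ L⟨t[x←u]⟩` and `(s) t[x←u] ↦ t{x:=u}`. -/
inductive NRoot : NRule → LT → LT → Prop
  | dB (t u : LT) (L : List LT) :
      NRoot NRule.dB (LT.app (fillLN (LT.lam t) L) u)
        (fillLN (LT.sub t (LT.liftN L.length u)) L)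
  | s (t u : LT) : NRoot NRule.s (LT.sub t u) (LT.subst t 0 u)

/-- The names of the CBV rewrite rules: `dB` and `sV`. -/
inductive VRule : Type
  | dB : VRule
  | sV : VRule

/-- Root steps of the CBV rules:
`(dB) L⟨λx.t⟩ u ↦ L⟨t[x←u]⟩` and `(sV) t[x←L⟨v⟩] ↦ L⟨t{x:=v}⟩` for `v` a value. -/
inductive VRoot : VRule → LT → LT → Prop
  | dB (t u : LT) (L : List LT) :
      VRoot VRule.dB (LT.app (fillLN (LT.lam t) L) u)
        (fillLN (LT.sub t (LT.liftN L.length u)) L)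
  | sV (t v : LT) (L : List LT) : v.IsValue →
      VRoot VRule.sV (LT.sub t (fillLN v L))
        (fillLN (LT.subst (LT.liftUnder L.length t) 0 v) L)

/-- (Full) contexts of the CBN/CBV calculi. -/
inductive LCtx : Type
  | hole : LCtx
  | appL : LCtx → LT → LCtx
  | appR : LT → LCtx → LCtx
  | lam : LCtx → LCtx
  | subL : LCtx → LT → LCtx
  | subR : LT → LCtx → LCtx

namespace LCtx

/-- Plugging a term in a CBN/CBV context. -/
def fill : LCtx → LT → LT
  | hole, s => s
  | appL C t, s => LT.app (fill C s) t
  | appR t C, s => LT.app t (fill C s)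
  | lam C, s => LT.lam (fill C s)
  | subL C t, s => LT.sub (fill C s) t
  | subR t C, s => LT.sub t (fill C s)

/-- CBN surface contexts: the hole never occurs in the argument of an application
or of an explicit substitution. -/
def NSurface : LCtx → Prop
  | hole => True
  | appL C _ => NSurface C
  | appR _ _ => False
  | lam C => NSurface C
  | subL C _ => NSurface C
  | subR _ _ => False

/-- CBV surface contexts: the hole never occurs under an abstraction. -/
def VSurface : LCtx → Prop
  | hole => True
  | appL C _ => VSurface C
  | appR _ C => VSurface C
  | lam _ => False
  | subL C _ => VSurface C
  | subR _ C => VSurface C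

end LCtx

/-- `NStepAt R C t u`: the CBN step firing rule `R` under context `C`. -/
def NStepAt (R : NRule) (C : LCtx) (t u : LT) : Prop :=
  ∃ a b, NRoot R a b ∧ t = C.fill a ∧ u = C.fill b

/-- `VStepAt R C t u`: the CBV step firing rule `R` under context `C`. -/
def VStepAt (R : VRule) (C : LCtx) (t u : LT) : Prop :=
  ∃ a b, VRoot R a b ∧ t = C.fill a ∧ u = C.fill b

/-- One CBN step of rule `R` under some full context. -/
def NFStepR (R : NRule) (t u : LT) : Prop := ∃ C : LCtx, NStepAt R C t u

/-- One CBN step of rule `R` under some surface context. -/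
def NSStepR (R : NRule) (t u : LT) : Prop := ∃ C : LCtx, C.NSurface ∧ NStepAt R C t u

/-- One CBN step of rule `R` under some internal context. -/
def NIStepR (R : NRule) (t u : LT) : Prop := ∃ C : LCtx, ¬ C.NSurface ∧ NStepAt R C t u

/-- CBN full reduction `→ⁿF`. -/
def NFStep (t u : LT) : Prop := ∃ R, NFStepR R t u

/-- CBN surface reduction `→ⁿS`. -/
def NSStep (t u : LT) : Prop := ∃ R, NSStepR R t u

/-- CBN internal reduction `→ⁿI`. -/
def NIStep (t u : LT) : Prop := ∃ R, NIStepR R t u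

/-- One CBV step of rule `R` under some full context. -/
def VFStepR (R : VRule) (t u : LT) : Prop := ∃ C : LCtx, VStepAt R C t u

/-- One CBV step of rule `R` under some surface context. -/
def VSStepR (R : VRule) (t u : LT) : Prop := ∃ C : LCtx, C.VSurface ∧ VStepAt R C t u

/-- One CBV step of rule `R` under some internal context. -/
def VIStepR (R : VRule) (t u : LT) : Prop := ∃ C : LCtx, ¬ C.VSurface ∧ VStepAt R C t u

/-- CBV full reduction `→ᵛF`. -/
def VFStep (t u : LT) : Prop := ∃ R, VFStepR R t u

/-- CBV surface reduction `→ᵛS`. -/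
def VSStep (t u : LT) : Prop := ∃ R, VSStepR R t u

/-- CBV internal reduction `→ᵛI`. -/
def VIStep (t u : LT) : Prop := ∃ R, VIStepR R t u

/-! ### The CBN embedding into λ! -/

/-- The CBN embedding `(·)ⁿ : xⁿ = x, (λx.t)ⁿ = λx.tⁿ, (t u)ⁿ = tⁿ !(uⁿ),
(t[x←u])ⁿ = tⁿ[x←!(uⁿ)]`. -/
def embN : LT → T
  | LT.var n => T.var n
  | LT.app t u => T.app (embN t) (T.bang (embN u))
  | LT.lam t => T.lam (embN t)
  | LT.sub t u => T.sub (embN t) (T.bang (embN u))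

/-- The CBN embedding extended to contexts, with `⟨·⟩ⁿ = ⟨·⟩`. -/
def embNC : LCtx → Ctx
  | LCtx.hole => Ctx.hole
  | LCtx.appL C t => Ctx.appL (embNC C) (T.bang (embN t))
  | LCtx.appR t C => Ctx.appR (embN t) (Ctx.bang (embNC C))
  | LCtx.lam C => Ctx.lam (embNC C)
  | LCtx.subL C t => Ctx.subL (embNC C) (T.bang (embN t))
  | LCtx.subR t C => Ctx.subR (embN t) (Ctx.bang (embNC C))

/-- The CBN embedding on rule names: `dBⁿ = dB`, `sⁿ = s!`. -/
def embNRule : NRule → Rule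
  | NRule.dB => Rule.dB
  | NRule.s => Rule.sBang

/-! ### The CBV embedding into λ! -/

/-- If `t = L⟨!s⟩` for a list context `L`, return `some L⟨s⟩`, otherwise `none`. -/
def strip? : T → Option T
  | T.bang s => some s
  | T.sub a b => (strip? a).map (fun a' => T.sub a' b)
  | _ => none

/-- The (new) CBV embedding `(·)ᵛ : xᵛ = !x, (λx.t)ᵛ = !λx.!(tᵛ),
(t u)ᵛ = der(L⟨s⟩ uᵛ)` if `tᵛ = L⟨!s⟩` and `der(der(tᵛ) uᵛ)` otherwise,
`(t[x←u])ᵛ = tᵛ[x←uᵛ]`. -/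
def embV : LT → T
  | LT.var n => T.bang (T.var n)
  | LT.lam t => T.bang (T.lam (T.bang (embV t)))
  | LT.app t u =>
      match strip? (embV t) with
      | some s => T.der (T.app s (embV u))
      | none => T.der (T.app (T.der (embV t)) (embV u))
  | LT.sub t u => T.sub (embV t) (embV u)

/-- The CBV embedding on rule names: `dBᵛ = dB`, `sVᵛ = s!`. -/
def embVRule : VRule → Rule
  | VRule.dB => Rule.dB
  | VRule.sV => Rule.sBang

/-! ### Surface steps as structural inductive relations -/

/-- `Beta a u r`: `a = L⟨λx.t⟩` and `r = L⟨t[x←u]⟩`. -/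
inductive Beta : T → T → T → Prop
  | lam (t u : T) : Beta (T.lam t) u (T.sub t u)
  | sub {a b u r : T} : Beta a (T.lift 0 u) r → Beta (T.sub a b) u (T.sub r b)

/-- `Unbox t c r`: `c = L⟨!u⟩` and `r = L⟨t{x:=u}⟩`. -/
inductive Unbox : T → T → T → Prop
  | bang (t u : T) : Unbox t (T.bang u) (T.subst t 0 u)
  | sub {t c b r : T} : Unbox (T.lift 1 t) c r → Unbox t (T.sub c b) (T.sub r b)

/-- Surface reduction of λ!, with congruence rules in place of contexts. -/
inductive Step : Rule → T → T → Prop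
  | beta {a u r : T} : Beta a u r → Step Rule.dB (T.app a u) r
  | unbox {t c r : T} : Unbox t c r → Step Rule.sBang (T.sub t c) r
  | derBang {a r : T} : strip? a = some r → Step Rule.dBang (T.der a) r
  | appL {R : Rule} {a a' : T} (b : T) : Step R a a' → Step R (T.app a b) (T.app a' b)
  | appR {R : Rule} (a : T) {b b' : T} : Step R b b' → Step R (T.app a b) (T.app a b')
  | lam {R : Rule} {a a' : T} : Step R a a' → Step R (T.lam a) (T.lam a')
  | der {R : Rule} {a a' : T} : Step R a a' → Step R (T.der a) (T.der a')
  | subL {R : Rule} {a a' : T} (b : T) : Step R a a' → Step R (T.sub a b) (T.sub a' b)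
  | subR {R : Rule} (a : T) {b b' : T} : Step R b b' → Step R (T.sub a b) (T.sub a b')

theorem fillL_append_singleton (s b : T) (L : List T) :
    fillL s (L ++ [b]) = T.sub (fillL s L) b := by
  induction L generalizing s with
  | nil => rfl
  | cons c L ih => exact ih _

theorem T.liftN_succ (m : ℕ) (t : T) : T.liftN (m + 1) t = T.liftN m (T.lift 0 t) := rfl

theorem T.liftUnder_succ (m : ℕ) (t : T) :
    T.liftUnder (m + 1) t = T.liftUnder m (T.lift 1 t) := rfl

theorem beta_fillL (t u : T) (L : List T) :
    Beta (fillL (T.lam t) L) u (fillL (T.sub t (T.liftN L.length u)) L) := by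
  induction L using List.reverseRecOn generalizing u with
  | nil => exact .lam _ _
  | append_singleton L b ih =>
    simp only [fillL_append_singleton, List.length_append, List.length_singleton, T.liftN_succ]
    exact .sub (ih _)

theorem unbox_fillL (t u : T) (L : List T) :
    Unbox t (fillL (T.bang u) L) (fillL (T.subst (T.liftUnder L.length t) 0 u) L) := by
  induction L using List.reverseRecOn generalizing t with
  | nil => exact .bang _ _
  | append_singleton L b ih =>
    simp only [fillL_append_singleton, List.length_append, List.length_singleton,
      T.liftUnder_succ]
    exact .sub (ih _)

theorem strip?_fillL_bang (t : T) (L : List T) :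
    strip? (fillL (T.bang t) L) = some (fillL t L) := by
  induction L using List.reverseRecOn with
  | nil => rfl
  | append_singleton L b ih => simp [fillL_append_singleton, strip?, ih]

theorem Beta.exists_fillL {a u r : T} (h : Beta a u r) :
    ∃ t L, a = fillL (T.lam t) L ∧ r = fillL (T.sub t (T.liftN L.length u)) L := by
  induction h with
  | lam t u => exact ⟨t, [], rfl, rfl⟩
  | @sub a b u r _ ih =>
    obtain ⟨t, L, rfl, rfl⟩ := ih
    exact ⟨t, L ++ [b], by simp [fillL_append_singleton],
      by simp [fillL_append_singleton, T.liftN_succ]⟩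

theorem Unbox.exists_fillL {t c r : T} (h : Unbox t c r) :
    ∃ u L, c = fillL (T.bang u) L ∧
      r = fillL (T.subst (T.liftUnder L.length t) 0 u) L := by
  induction h with
  | bang t u => exact ⟨u, [], rfl, rfl⟩
  | @sub t c b r _ ih =>
    obtain ⟨u, L, rfl, rfl⟩ := ih
    exact ⟨u, L ++ [b], by simp [fillL_append_singleton],
      by simp [fillL_append_singleton, T.liftUnder_succ]⟩

theorem exists_fillL_of_strip? {a r : T} (h : strip? a = some r) :
    ∃ t L, a = fillL (T.bang t) L ∧ r = fillL t L := by
  induction a generalizing r with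
  | bang s => cases h; exact ⟨_, [], rfl, rfl⟩
  | sub a b iha _ =>
    simp only [strip?, Option.map_eq_some_iff] at h
    obtain ⟨a', ha, rfl⟩ := h
    obtain ⟨t, L, rfl, rfl⟩ := iha ha
    exact ⟨t, L ++ [b], by simp [fillL_append_singleton], by simp [fillL_append_singleton]⟩
  | var => cases h
  | app => cases h
  | lam => cases h
  | der => cases h

theorem Root.step {R : Rule} {a b : T} (h : Root R a b) : Step R a b := by
  cases h with
  | dB t u L => exact .beta (beta_fillL t u L)
  | sBang t u L => exact .unbox (unbox_fillL t u L)
  | dBang t L => exact .derBang (strip?_fillL_bang t L)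

theorem sStepR_iff_step {R : Rule} {a b : T} : SStepR R a b ↔ Step R a b := by
  constructor
  · rintro ⟨C, hC, a, b, h, rfl, rfl⟩
    induction C with
    | hole => exact h.step
    | appL C t ih => exact .appL _ (ih hC)
    | appR t C ih => exact .appR _ (ih hC)
    | lam C ih => exact .lam (ih hC)
    | bang C ih => exact hC.elim
    | der C ih => exact .der (ih hC)
    | subL C t ih => exact .subL _ (ih hC)
    | subR t C ih => exact .subR _ (ih hC)
  · intro h
    induction h with
    | @beta a u r h =>
      obtain ⟨t, L, rfl, rfl⟩ := h.exists_fillL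
      exact ⟨.hole, trivial, _, _, .dB t u L, rfl, rfl⟩
    | @unbox t c r h =>
      obtain ⟨u, L, rfl, rfl⟩ := h.exists_fillL
      exact ⟨.hole, trivial, _, _, .sBang t u L, rfl, rfl⟩
    | @derBang a r h =>
      obtain ⟨t, L, rfl, rfl⟩ := exists_fillL_of_strip? h
      exact ⟨.hole, trivial, _, _, .dBang t L, rfl, rfl⟩
    | appL b _ ih =>
      obtain ⟨C, hC, x, y, h, rfl, rfl⟩ := ih
      exact ⟨.appL C b, hC, x, y, h, rfl, rfl⟩
    | appR a _ ih =>
      obtain ⟨C, hC, x, y, h, rfl, rfl⟩ := ih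
      exact ⟨.appR a C, hC, x, y, h, rfl, rfl⟩
    | lam _ ih =>
      obtain ⟨C, hC, x, y, h, rfl, rfl⟩ := ih
      exact ⟨.lam C, hC, x, y, h, rfl, rfl⟩
    | der _ ih =>
      obtain ⟨C, hC, x, y, h, rfl, rfl⟩ := ih
      exact ⟨.der C, hC, x, y, h, rfl, rfl⟩
    | subL b _ ih =>
      obtain ⟨C, hC, x, y, h, rfl, rfl⟩ := ih
      exact ⟨.subL C b, hC, x, y, h, rfl, rfl⟩
    | subR a _ ih =>
      obtain ⟨C, hC, x, y, h, rfl, rfl⟩ := ih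
      exact ⟨.subR a C, hC, x, y, h, rfl, rfl⟩

theorem sStepR_eq_step : SStepR = Step := by
  ext R a b; exact sStepR_iff_step

/-- `VBeta t u r`: `t = L⟨λx.s⟩` and `r = L⟨s[x←u]⟩`. -/
inductive VBeta : LT → LT → LT → Prop
  | lam (t u : LT) : VBeta (LT.lam t) u (LT.sub t u)
  | sub {t s u r : LT} : VBeta t (LT.lift 0 u) r → VBeta (LT.sub t s) u (LT.sub r s)

/-- `VUnbox t u r`: `u = L⟨v⟩` with `v` a value, and `r = L⟨t{x:=v}⟩`. -/
inductive VUnbox : LT → LT → LT → Prop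
  | value (t : LT) {v : LT} : v.IsValue → VUnbox t v (LT.subst t 0 v)
  | sub {t u s r : LT} : VUnbox (LT.lift 1 t) u r → VUnbox t (LT.sub u s) (LT.sub r s)

/-- CBV surface reduction, with congruence rules in place of contexts. -/
inductive VStep : VRule → LT → LT → Prop
  | beta {t u r : LT} : VBeta t u r → VStep VRule.dB (LT.app t u) r
  | unbox {t u r : LT} : VUnbox t u r → VStep VRule.sV (LT.sub t u) r
  | appL {R : VRule} {t t' : LT} (u : LT) : VStep R t t' → VStep R (LT.app t u) (LT.app t' u)
  | appR {R : VRule} (t : LT) {u u' : LT} : VStep R u u' → VStep R (LT.app t u) (LT.app t u')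
  | subL {R : VRule} {t t' : LT} (u : LT) : VStep R t t' → VStep R (LT.sub t u) (LT.sub t' u)
  | subR {R : VRule} (t : LT) {u u' : LT} : VStep R u u' → VStep R (LT.sub t u) (LT.sub t u')

theorem fillLN_append_singleton (s b : LT) (L : List LT) :
    fillLN s (L ++ [b]) = LT.sub (fillLN s L) b := by
  induction L generalizing s with
  | nil => rfl
  | cons c L ih => exact ih _

theorem LT.liftN_succ (m : ℕ) (t : LT) : LT.liftN (m + 1) t = LT.liftN m (LT.lift 0 t) := rfl

theorem LT.liftUnder_succ (m : ℕ) (t : LT) :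
    LT.liftUnder (m + 1) t = LT.liftUnder m (LT.lift 1 t) := rfl

theorem vBeta_fillLN (t u : LT) (L : List LT) :
    VBeta (fillLN (LT.lam t) L) u (fillLN (LT.sub t (LT.liftN L.length u)) L) := by
  induction L using List.reverseRecOn generalizing u with
  | nil => exact .lam _ _
  | append_singleton L b ih =>
    simp only [fillLN_append_singleton, List.length_append, List.length_singleton,
      LT.liftN_succ]
    exact .sub (ih _)

theorem vUnbox_fillLN (t : LT) {v : LT} (hv : v.IsValue) (L : List LT) :
    VUnbox t (fillLN v L) (fillLN (LT.subst (LT.liftUnder L.length t) 0 v) L) := by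
  induction L using List.reverseRecOn generalizing t with
  | nil => exact .value _ hv
  | append_singleton L b ih =>
    simp only [fillLN_append_singleton, List.length_append, List.length_singleton,
      LT.liftUnder_succ]
    exact .sub (ih _)

theorem VBeta.exists_fillLN {t u r : LT} (h : VBeta t u r) :
    ∃ s L, t = fillLN (LT.lam s) L ∧ r = fillLN (LT.sub s (LT.liftN L.length u)) L := by
  induction h with
  | lam t u => exact ⟨t, [], rfl, rfl⟩
  | @sub t b u r _ ih =>
    obtain ⟨s, L, rfl, rfl⟩ := ih
    exact ⟨s, L ++ [b], by simp [fillLN_append_singleton],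
      by simp [fillLN_append_singleton, LT.liftN_succ]⟩

theorem VUnbox.exists_fillLN {t u r : LT} (h : VUnbox t u r) :
    ∃ v L, v.IsValue ∧ u = fillLN v L ∧
      r = fillLN (LT.subst (LT.liftUnder L.length t) 0 v) L := by
  induction h with
  | value t hv => exact ⟨_, [], hv, rfl, rfl⟩
  | @sub t u b r _ ih =>
    obtain ⟨v, L, hv, rfl, rfl⟩ := ih
    exact ⟨v, L ++ [b], hv, by simp [fillLN_append_singleton],
      by simp [fillLN_append_singleton, LT.liftUnder_succ]⟩

theorem VRoot.vStep {R : VRule} {t u : LT} (h : VRoot R t u) : VStep R t u := by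
  cases h with
  | dB t u L => exact .beta (vBeta_fillLN t u L)
  | sV t v L hv => exact .unbox (vUnbox_fillLN t hv L)

theorem vSStepR_iff_vStep {R : VRule} {t u : LT} : VSStepR R t u ↔ VStep R t u := by
  constructor
  · rintro ⟨C, hC, a, b, h, rfl, rfl⟩
    induction C with
    | hole => exact h.vStep
    | appL C t ih => exact .appL _ (ih hC)
    | appR t C ih => exact .appR _ (ih hC)
    | lam C ih => exact hC.elim
    | subL C t ih => exact .subL _ (ih hC)
    | subR t C ih => exact .subR _ (ih hC)
  · intro h
    induction h with
    | @beta t u r h =>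
      obtain ⟨s, L, rfl, rfl⟩ := h.exists_fillLN
      exact ⟨.hole, trivial, _, _, .dB s u L, rfl, rfl⟩
    | @unbox t u r h =>
      obtain ⟨v, L, hv, rfl, rfl⟩ := h.exists_fillLN
      exact ⟨.hole, trivial, _, _, .sV t v L hv, rfl, rfl⟩
    | appL b _ ih =>
      obtain ⟨C, hC, x, y, h, rfl, rfl⟩ := ih
      exact ⟨.appL C b, hC, x, y, h, rfl, rfl⟩
    | appR a _ ih =>
      obtain ⟨C, hC, x, y, h, rfl, rfl⟩ := ih
      exact ⟨.appR a C, hC, x, y, h, rfl, rfl⟩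
    | subL b _ ih =>
      obtain ⟨C, hC, x, y, h, rfl, rfl⟩ := ih
      exact ⟨.subL C b, hC, x, y, h, rfl, rfl⟩
    | subR a _ ih =>
      obtain ⟨C, hC, x, y, h, rfl, rfl⟩ := ih
      exact ⟨.subR a C, hC, x, y, h, rfl, rfl⟩

theorem vSStepR_eq_vStep : VSStepR = VStep := by
  ext R t u; exact vSStepR_iff_vStep

/-! ### The embedding commutes with lifting and with substitution of values -/

theorem strip?_lift (k : ℕ) (a : T) : strip? (T.lift k a) = (strip? a).map (T.lift k) := by
  induction a generalizing k with
  | var n => simp only [T.lift, strip?]; split <;> rfl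
  | sub a b iha _ =>
    simp only [T.lift, strip?, iha, Option.map_map]
    cases h : strip? a with
    | none => rfl
    | some s =>
      have := iha (k + 1)
      simp_all [T.lift]
  | _ => rfl

theorem embV_lift (k : ℕ) (t : LT) : embV (LT.lift k t) = T.lift k (embV t) := by
  induction t generalizing k with
  | var n => simp only [LT.lift, embV, T.lift]; split <;> rfl
  | lam t ih => simp [LT.lift, embV, T.lift, ih]
  | sub t u iht ihu => simp [LT.lift, embV, T.lift, iht, ihu]
  | app t u iht ihu =>
    simp only [LT.lift, embV, iht, ihu, strip?_lift]
    cases strip? (embV t) <;> rfl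

theorem embV_liftN (m : ℕ) (t : LT) : embV (LT.liftN m t) = T.liftN m (embV t) := by
  induction m generalizing t with
  | zero => rfl
  | succ m ih => rw [LT.liftN_succ, T.liftN_succ, ih, embV_lift]

theorem T.liftN_bang (m : ℕ) (a : T) : T.liftN m (T.bang a) = T.bang (T.liftN m a) := by
  induction m generalizing a with
  | zero => rfl
  | succ m ih => simp [T.liftN_succ, T.lift, ih]

theorem strip?_subst_embV (k : ℕ) (t : LT) (v : T) :
    strip? (T.subst (embV t) k v) = (strip? (embV t)).map (fun a => T.subst a k v) := by
  induction t generalizing k with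
  | var n => rfl
  | lam t ih => rfl
  | sub t u iht _ =>
    simp only [embV, T.subst, strip?, iht, Option.map_map]
    rfl
  | app t u _ _ =>
    simp only [embV]
    cases strip? (embV t) <;> rfl

theorem embV_subst (k : ℕ) (t : LT) {v : LT} {w : T} (hv : embV v = T.bang w) :
    embV (LT.subst t k v) = T.subst (embV t) k w := by
  induction t generalizing k with
  | var n =>
    simp only [LT.subst, embV, T.subst]
    split
    · rfl
    · split
      · rw [embV_liftN, hv, T.liftN_bang]
      · rfl
  | lam t ih => simp [LT.subst, embV, T.subst, ih]
  | sub t u iht ihu => simp [LT.subst, embV, T.subst, iht, ihu]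
  | app t u iht ihu =>
    simp only [LT.subst, embV, iht, ihu, strip?_subst_embV]
    cases strip? (embV t) <;> rfl

/-! ### Terms representing a CBV term up to pending `d!`-steps -/

/-- The three shapes in which a CBV term can be represented in λ!. -/
inductive Mode : Type
  /-- up to pending `d!`-steps, the embedding of the term -/
  | plain : Mode
  /-- `L⟨s⟩` where `L⟨!s⟩` represents the term and `!s` is the embedding of a value -/
  | stripped : Mode
  /-- `L⟨!s⟩` where `L⟨s⟩` represents the term -/
  | boxed : Mode

/-- `Rep m t a`: the λ!-term `a` represents the CBV term `t` in mode `m`. -/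
inductive Rep : Mode → LT → T → Prop
  | var (n : ℕ) : Rep .plain (LT.var n) (T.bang (T.var n))
  | lam (t : LT) : Rep .plain (LT.lam t) (T.bang (T.lam (T.bang (embV t))))
  | strippedVar (n : ℕ) : Rep .stripped (LT.var n) (T.var n)
  | strippedLam (t : LT) : Rep .stripped (LT.lam t) (T.lam (T.bang (embV t)))
  | box (t : LT) : Rep .boxed t (T.bang (embV t))
  | sub {m : Mode} {t u : LT} {a b : T} :
      Rep m t a → Rep .plain u b → Rep m (LT.sub t u) (T.sub a b)
  | app {t u : LT} {a b : T} :
      Rep .plain t a → Rep .plain u b →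
        Rep .plain (LT.app t u) (T.der (T.app (T.der a) b))
  | strippedApp {t u : LT} {a b : T} :
      Rep .stripped t a → Rep .plain u b → Rep .plain (LT.app t u) (T.der (T.app a b))
  | der {t : LT} {a : T} : Rep .boxed t a → Rep .plain t (T.der a)

theorem Rep.stripped_of_strip? {t : LT} {a r : T} (h : Rep .plain t a)
    (hr : strip? a = some r) : Rep .stripped t r := by
  induction a generalizing t r with
  | bang s =>
    cases hr
    cases h with
    | var n => exact .strippedVar n
    | lam t => exact .strippedLam t
  | sub a b iha _ =>
    simp only [strip?, Option.map_eq_some_iff] at hr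
    obtain ⟨a', ha, rfl⟩ := hr
    cases h with
    | sub h₁ h₂ => exact .sub (iha h₁ ha) h₂
  | var => cases hr
  | app => cases hr
  | lam => cases hr
  | der => cases hr

theorem rep_embV (t : LT) : Rep .plain t (embV t) := by
  induction t with
  | var n => exact .var n
  | lam t _ => exact .lam t
  | sub t u iht ihu => exact .sub iht ihu
  | app t u iht ihu =>
    simp only [embV]
    cases h : strip? (embV t) with
    | none => exact .app iht ihu
    | some s => exact .strippedApp (iht.stripped_of_strip? h) ihu

theorem Rep.plain_of_strip? {t : LT} {a r : T} (h : Rep .boxed t a)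
    (hr : strip? a = some r) : Rep .plain t r := by
  induction a generalizing t r with
  | bang s =>
    cases hr
    cases h
    exact rep_embV t
  | sub a b iha _ =>
    simp only [strip?, Option.map_eq_some_iff] at hr
    obtain ⟨a', ha, rfl⟩ := hr
    cases h with
    | sub h₁ h₂ => exact .sub (iha h₁ ha) h₂
  | var => cases hr
  | app => cases hr
  | lam => cases hr
  | der => cases hr

theorem Rep.lift {m : Mode} {t : LT} {a : T} (h : Rep m t a) (k : ℕ) :
    Rep m (LT.lift k t) (T.lift k a) := by
  induction h generalizing k with
  | var n => simp only [LT.lift, T.lift]; split <;> exact .var _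
  | lam t => simpa only [LT.lift, T.lift, embV_lift] using Rep.lam (LT.lift (k + 1) t)
  | strippedVar n => simp only [LT.lift, T.lift]; split <;> exact .strippedVar _
  | strippedLam t =>
    simpa only [LT.lift, T.lift, embV_lift] using Rep.strippedLam (LT.lift (k + 1) t)
  | box t => simpa only [T.lift, embV_lift] using Rep.box (LT.lift k t)
  | sub _ _ iha ihb => exact .sub (iha _) (ihb _)
  | app _ _ iha ihb => exact .app (iha _) (ihb _)
  | strippedApp _ _ iha ihb => exact .strippedApp (iha _) (ihb _)
  | der _ ih => exact .der (ih _)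

theorem Rep.subst {m : Mode} {t : LT} {a : T} (h : Rep m t a) (k : ℕ) {v : LT} {w : T}
    (hv : embV v = T.bang w) : Rep m (LT.subst t k v) (T.subst a k w) := by
  induction h generalizing k with
  | var n =>
    have := rep_embV (LT.subst (LT.var n) k v)
    rwa [embV_subst k _ hv] at this
  | lam t =>
    have := rep_embV (LT.subst (LT.lam t) k v)
    rwa [embV_subst k _ hv] at this
  | strippedVar n =>
    have := rep_embV (LT.subst (LT.var n) k v)
    rw [embV_subst k _ hv] at this
    exact this.stripped_of_strip? rfl
  | strippedLam t =>
    have := rep_embV (LT.subst (LT.lam t) k v)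
    rw [embV_subst k _ hv] at this
    exact this.stripped_of_strip? rfl
  | box t =>
    have := Rep.box (LT.subst t k v)
    rwa [embV_subst k _ hv] at this
  | sub _ _ iha ihb => exact .sub (iha _) (ihb _)
  | app _ _ iha ihb => exact .app (iha _) (ihb _)
  | strippedApp _ _ iha ihb => exact .strippedApp (iha _) (ihb _)
  | der _ ih => exact .der (ih _)

theorem Rep.exists_of_lam {m : Mode} {t : LT} {a : T} (h : Rep m t (T.lam a)) :
    ∃ s, t = LT.lam s ∧ Rep .boxed s a := by
  cases h
  exact ⟨_, rfl, .box _⟩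

theorem Rep.unique {m : Mode} {t t' : LT} {a : T} (h : Rep m t a) (h' : Rep m t' a) :
    t = t' := by
  induction hn : sizeOf a using Nat.strong_induction_on generalizing m t t' a with
  | _ n ih =>
  subst hn
  cases a with
  | var n => cases h; cases h'; rfl
  | app a b => cases h
  | lam a =>
    obtain ⟨s, rfl, hs⟩ := h.exists_of_lam
    obtain ⟨s', rfl, hs'⟩ := h'.exists_of_lam
    rw [ih _ (by simp) hs hs' rfl]
  | bang a =>
    cases m with
    | plain =>
      exact ih _ (by simp) (h.stripped_of_strip? rfl) (h'.stripped_of_strip? rfl) rfl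
    | stripped => cases h
    | boxed => exact ih _ (by simp) (h.plain_of_strip? rfl) (h'.plain_of_strip? rfl) rfl
  | der a =>
    cases h with
    | app h₁ h₂ =>
      cases h' with
      | app h₃ h₄ =>
        rw [ih _ (by simp; omega) h₁ h₃ rfl, ih _ (by simp; omega) h₂ h₄ rfl]
      | strippedApp h₃ h₄ => cases h₃
      | der h₃ => cases h₃
    | strippedApp h₁ h₂ =>
      cases h' with
      | app h₃ h₄ => cases h₁
      | strippedApp h₃ h₄ =>
        rw [ih _ (by simp; omega) h₁ h₃ rfl, ih _ (by simp; omega) h₂ h₄ rfl]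
      | der h₃ => cases h₃
    | der h₁ =>
      cases h' with
      | app h₃ h₄ => cases h₁
      | strippedApp h₃ h₄ => cases h₁
      | der h₃ => exact ih _ (by simp) h₁ h₃ rfl
  | sub a b =>
    cases h with
    | sub h₁ h₂ =>
      cases h' with
      | sub h₃ h₄ =>
        rw [ih _ (by simp; omega) h₁ h₃ rfl, ih _ (by simp) h₂ h₄ rfl]

/-! ### Simulation of λ! steps by CBV steps -/

theorem Rep.vBeta {t u : LT} {a b r : T} (h : Rep .stripped t a) (hu : Rep .plain u b)
    (hr : Beta a b r) : ∃ t', VBeta t u t' ∧ Rep .boxed t' r := by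
  induction hr generalizing t u with
  | lam s b =>
    cases h with
    | strippedLam t => exact ⟨_, .lam _ _, .sub (.box t) hu⟩
  | sub _ ih =>
    cases h with
    | sub h₁ h₂ =>
      obtain ⟨t', ht, hr⟩ := ih h₁ (hu.lift 0)
      exact ⟨_, .sub ht, .sub hr h₂⟩

theorem Rep.value_of_bang {u : LT} {w : T} (h : Rep .plain u (T.bang w)) :
    u.IsValue ∧ embV u = T.bang w := by
  cases h <;> exact ⟨trivial, rfl⟩

theorem Rep.vUnbox {m : Mode} {t u : LT} {a b r : T} (h : Rep m t a) (hu : Rep .plain u b)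
    (hr : Unbox a b r) : ∃ t', VUnbox t u t' ∧ Rep m t' r := by
  induction hr generalizing t u with
  | bang s w =>
    obtain ⟨hv, hw⟩ := hu.value_of_bang
    exact ⟨_, .value _ hv, h.subst 0 hw⟩
  | sub _ ih =>
    cases hu with
    | sub h₁ h₂ =>
      obtain ⟨t', ht, hr⟩ := ih (h.lift 1) h₁
      exact ⟨_, .sub ht, .sub hr h₂⟩

/-- The CBV reduction simulating a given rule of λ!. -/
def Sim : Rule → LT → LT → Prop
  | .dB => VStep .dB
  | .sBang => VStep .sV
  | .dBang => Eq

theorem Sim.congr {R : Rule} {t t' : LT} (f : LT → LT) (h : Sim R t t')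
    (hf : ∀ R, VStep R t t' → VStep R (f t) (f t')) : Sim R (f t) (f t') := by
  cases R with
  | dB => exact hf _ h
  | sBang => exact hf _ h
  | dBang => exact congrArg f h

theorem Rep.sim {m : Mode} {t : LT} {a a' : T} {R : Rule} (h : Rep m t a)
    (hs : Step R a a') : ∃ t', Sim R t t' ∧ Rep m t' a' := by
  induction h generalizing a' with
  | var n => cases hs
  | strippedVar n => cases hs
  | lam t => cases hs
  | strippedLam t => cases hs with | lam hs => cases hs
  | box t => cases hs
  | @sub m t u a b h₁ h₂ ih₁ ih₂ =>
    cases hs with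
    | unbox hr =>
      obtain ⟨t', ht, hr⟩ := h₁.vUnbox h₂ hr
      exact ⟨t', .unbox ht, hr⟩
    | subL _ hs =>
      obtain ⟨t', ht, hr⟩ := ih₁ hs
      exact ⟨_, ht.congr (LT.sub · u) fun _ => .subL u, .sub hr h₂⟩
    | subR _ hs =>
      obtain ⟨t', ht, hr⟩ := ih₂ hs
      exact ⟨_, ht.congr (LT.sub t) fun _ => .subR t, .sub h₁ hr⟩
  | @app t u a b h₁ h₂ ih₁ ih₂ =>
    cases hs with
    | derBang hs => cases hs
    | der hs =>
      cases hs with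
      | beta hs => cases hs
      | appL _ hs =>
        cases hs with
        | derBang hs => exact ⟨_, rfl, .strippedApp (h₁.stripped_of_strip? hs) h₂⟩
        | der hs =>
          obtain ⟨t', ht, hr⟩ := ih₁ hs
          exact ⟨_, ht.congr (LT.app · u) fun _ => .appL u, .app hr h₂⟩
      | appR _ hs =>
        obtain ⟨t', ht, hr⟩ := ih₂ hs
        exact ⟨_, ht.congr (LT.app t) fun _ => .appR t, .app h₁ hr⟩
  | @strippedApp t u a b h₁ h₂ ih₁ ih₂ =>
    cases hs with
    | derBang hs => cases hs
    | der hs =>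
      cases hs with
      | beta hs =>
        obtain ⟨t', ht, hr⟩ := h₁.vBeta h₂ hs
        exact ⟨t', .beta ht, .der hr⟩
      | appL _ hs =>
        obtain ⟨t', ht, hr⟩ := ih₁ hs
        exact ⟨_, ht.congr (LT.app · u) fun _ => .appL u, .strippedApp hr h₂⟩
      | appR _ hs =>
        obtain ⟨t', ht, hr⟩ := ih₂ hs
        exact ⟨_, ht.congr (LT.app t) fun _ => .appR t, .strippedApp h₁ hr⟩
  | @der t a h ih =>
    cases hs with
    | derBang hs => exact ⟨_, rfl, h.plain_of_strip? hs⟩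
    | der hs =>
      obtain ⟨t', ht, hr⟩ := ih hs
      exact ⟨t', ht, .der hr⟩

/-! ### Administrative reduction to the embedding -/

open Relation in
theorem Rep.reduces {m : Mode} {t : LT} {a : T} (h : Rep m t a) :
    match m with
    | .plain => ReflTransGen (Step .dBang) a (embV t)
    | .stripped => ∃ s, strip? (embV t) = some s ∧ ReflTransGen (Step .dBang) a s
    | .boxed => ∃ s, strip? s = some (embV t) ∧ ReflTransGen (Step .dBang) a s := by
  have sub_congr : ∀ {a a' b b' : T}, ReflTransGen (Step .dBang) a a' →
      ReflTransGen (Step .dBang) b b' →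
      ReflTransGen (Step .dBang) (T.sub a b) (T.sub a' b') := fun ha hb =>
    (ha.lift (T.sub · _) fun _ _ => .subL _).trans (hb.lift (T.sub _) fun _ _ => .subR _)
  have app_congr : ∀ {a a' b b' : T}, ReflTransGen (Step .dBang) a a' →
      ReflTransGen (Step .dBang) b b' →
      ReflTransGen (Step .dBang) (T.der (T.app a b)) (T.der (T.app a' b')) := fun ha hb =>
    (ha.lift (fun x => T.der (T.app x _)) fun _ _ h => .der (.appL _ h)).trans
      (hb.lift (fun x => T.der (T.app _ x)) fun _ _ h => .der (.appR _ h))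
  induction h with
  | var n => exact .refl
  | lam t => exact .refl
  | strippedVar n => exact ⟨_, rfl, .refl⟩
  | strippedLam n => exact ⟨_, rfl, .refl⟩
  | box t => exact ⟨_, rfl, .refl⟩
  | @sub m t u a b h₁ h₂ ih₁ ih₂ =>
    cases m with
    | plain => exact sub_congr ih₁ ih₂
    | stripped =>
      obtain ⟨s, hs, ha⟩ := ih₁
      exact ⟨T.sub s (embV u), by simp [embV, strip?, hs], sub_congr ha ih₂⟩
    | boxed =>
      obtain ⟨s, hs, ha⟩ := ih₁
      exact ⟨T.sub s (embV u), by simp [embV, strip?, hs], sub_congr ha ih₂⟩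
  | @app t u a b h₁ h₂ ih₁ ih₂ =>
    have hd := ih₁.lift T.der fun _ _ => Step.der
    simp only [embV]
    cases h : strip? (embV t) with
    | none => exact app_congr hd ih₂
    | some s => exact app_congr (hd.tail (.derBang h)) ih₂
  | @strippedApp t u a b h₁ h₂ ih₁ ih₂ =>
    obtain ⟨s, hs, ha⟩ := ih₁
    simp only [embV, hs]
    exact app_congr ha ih₂
  | der h ih =>
    obtain ⟨s, hs, ha⟩ := ih
    exact (ha.lift T.der fun _ _ => Step.der).tail (.derBang hs)

theorem isNF_dBang_embV (t : LT) :
    IsNF (Step .dBang) (embV t) ∧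
      ∀ s, strip? (embV t) = some s → IsNF (Step .dBang) s := by
  induction t with
  | var n =>
    refine ⟨fun b h => (nomatch h), fun s hs b h => ?_⟩
    cases hs; cases h
  | lam t _ =>
    refine ⟨fun b h => (nomatch h), fun s hs b h => ?_⟩
    cases hs
    cases h with | lam h => cases h
  | sub t u iht ihu =>
    refine ⟨fun b h => ?_, fun s hs b h => ?_⟩
    · cases h with
      | subL _ h => exact iht.1 _ h
      | subR _ h => exact ihu.1 _ h
    · simp only [embV, strip?, Option.map_eq_some_iff] at hs
      obtain ⟨s, hs, rfl⟩ := hs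
      cases h with
      | subL _ h => exact iht.2 s hs _ h
      | subR _ h => exact ihu.1 _ h
  | app t u iht ihu =>
    cases ht : strip? (embV t) with
    | none =>
      simp only [embV, ht]
      refine ⟨fun b h => ?_, fun s hs => by cases hs⟩
      cases h with
      | derBang h => cases h
      | der h =>
        cases h with
        | appL _ h =>
          cases h with
          | derBang h => simp [ht] at h
          | der h => exact iht.1 _ h
        | appR _ h => exact ihu.1 _ h
    | some s =>
      simp only [embV, ht]
      refine ⟨fun b h => ?_, fun s hs => by cases hs⟩
      cases h with
      | derBang h => cases h
      | der h =>
        cases h with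
        | appL _ h => exact iht.2 s ht _ h
        | appR _ h => exact ihu.1 _ h

/-! ### Simulation of CBV steps by λ! steps -/

theorem VBeta.exists_beta {t u t' : LT} (h : VBeta t u t') :
    ∃ s r, strip? (embV t) = some s ∧ Beta s (embV u) r ∧ Rep .boxed t' r := by
  induction h with
  | lam t u => exact ⟨_, _, rfl, .lam _ _, .sub (.box t) (rep_embV u)⟩
  | @sub t b u r _ ih =>
    obtain ⟨s, r, hs, hr, h⟩ := ih
    rw [embV_lift] at hr
    exact ⟨T.sub s (embV b), _, by simp [embV, strip?, hs], .sub hr, .sub h (rep_embV b)⟩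

theorem VUnbox.exists_unbox {m : Mode} {t u t' : LT} {a : T} (h : VUnbox t u t')
    (ha : Rep m t a) : ∃ r, Unbox a (embV u) r ∧ Rep m t' r := by
  induction h generalizing a with
  | @value t v hv =>
    obtain ⟨w, hw⟩ : ∃ w, embV v = T.bang w := by
      cases v with
      | var n => exact ⟨_, rfl⟩
      | lam t => exact ⟨_, rfl⟩
      | app t u => exact hv.elim
      | sub t u => exact hv.elim
    rw [hw]
    exact ⟨_, .bang _ _, ha.subst 0 hw⟩
  | @sub t u b r _ ih =>
    obtain ⟨r, hr, h⟩ := ih (ha.lift 1)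
    exact ⟨_, .sub hr, .sub h (rep_embV b)⟩

theorem VStep.exists_step {R : VRule} {t t' : LT} (h : VStep R t t') :
    (∃ a, Step (embVRule R) (embV t) a ∧ Rep .plain t' a) ∧
      ∀ s, strip? (embV t) = some s → ∃ a, Step (embVRule R) s a ∧ Rep .stripped t' a := by
  have strip_app : ∀ t u : LT, strip? (embV (LT.app t u)) = none := fun t u => by
    simp only [embV]
    cases strip? (embV t) <;> rfl
  induction h with
  | @beta t u r h =>
    refine ⟨?_, fun s hs => by simp [strip_app] at hs⟩
    obtain ⟨s, r, hs, hr, h⟩ := h.exists_beta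
    simp only [embV, hs]
    exact ⟨_, .der (.beta hr), .der h⟩
  | @unbox t u r h =>
    refine ⟨?_, fun s hs => ?_⟩
    · obtain ⟨r, hr, h⟩ := h.exists_unbox (rep_embV t)
      exact ⟨r, .unbox hr, h⟩
    · simp only [embV, strip?, Option.map_eq_some_iff] at hs
      obtain ⟨s, hs, rfl⟩ := hs
      obtain ⟨r, hr, h⟩ := h.exists_unbox ((rep_embV t).stripped_of_strip? hs)
      exact ⟨r, .unbox hr, h⟩
  | @appL R t t' u _ ih =>
    refine ⟨?_, fun s hs => by simp [strip_app] at hs⟩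
    simp only [embV]
    cases ht : strip? (embV t) with
    | none =>
      obtain ⟨a, ha, h⟩ := ih.1
      exact ⟨_, .der (.appL _ (.der ha)), .app h (rep_embV u)⟩
    | some s =>
      obtain ⟨a, ha, h⟩ := ih.2 s ht
      exact ⟨_, .der (.appL _ ha), .strippedApp h (rep_embV u)⟩
  | @appR R t u u' _ ih =>
    refine ⟨?_, fun s hs => by simp [strip_app] at hs⟩
    obtain ⟨a, ha, h⟩ := ih.1
    simp only [embV]
    cases ht : strip? (embV t) with
    | none => exact ⟨_, .der (.appR _ ha), .app (rep_embV t) h⟩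
    | some s =>
      exact ⟨_, .der (.appR _ ha), .strippedApp ((rep_embV t).stripped_of_strip? ht) h⟩
  | @subL R t t' u _ ih =>
    refine ⟨?_, fun s hs => ?_⟩
    · obtain ⟨a, ha, h⟩ := ih.1
      exact ⟨_, .subL _ ha, .sub h (rep_embV u)⟩
    · simp only [embV, strip?, Option.map_eq_some_iff] at hs
      obtain ⟨s, hs, rfl⟩ := hs
      obtain ⟨a, ha, h⟩ := ih.2 s hs
      exact ⟨_, .subL _ ha, .sub h (rep_embV u)⟩
  | @subR R t u u' _ ih =>
    obtain ⟨a, ha, h⟩ := ih.1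
    refine ⟨⟨_, .subR _ ha, .sub (rep_embV t) h⟩, fun s hs => ?_⟩
    simp only [embV, strip?, Option.map_eq_some_iff] at hs
    obtain ⟨s, hs, rfl⟩ := hs
    exact ⟨_, .subR _ ha, .sub ((rep_embV t).stripped_of_strip? hs) h⟩

/-! ### Counted reduction sequences -/

section Counted

open Relation

variable {α : Type*} {r₁ r₂ r₃ : α → α → Prop}

theorem exists_counted2_iff {a b : α} :
    (∃ m n, Counted2 r₁ r₂ m n a b) ↔ ReflTransGen (fun x y => r₁ x y ∨ r₂ x y) a b := by
  constructor
  · rintro ⟨m, n, h⟩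
    induction h with
    | refl => exact .refl
    | step₁ h _ ih => exact .head (.inl h) ih
    | step₂ h _ ih => exact .head (.inr h) ih
  · intro h
    induction h using ReflTransGen.head_induction_on with
    | refl => exact ⟨0, 0, .refl _⟩
    | head h _ ih =>
      obtain ⟨m, n, ih⟩ := ih
      rcases h with h | h
      · exact ⟨_, _, .step₁ h ih⟩
      · exact ⟨_, _, .step₂ h ih⟩

theorem exists_counted3_iff {a b : α} :
    (∃ m n k, Counted3 r₁ r₂ r₃ m n k a b) ↔
      ReflTransGen (fun x y => r₁ x y ∨ r₂ x y ∨ r₃ x y) a b := by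
  constructor
  · rintro ⟨m, n, k, h⟩
    induction h with
    | refl => exact .refl
    | step₁ h _ ih => exact .head (.inl h) ih
    | step₂ h _ ih => exact .head (.inr (.inl h)) ih
    | step₃ h _ ih => exact .head (.inr (.inr h)) ih
  · intro h
    induction h using ReflTransGen.head_induction_on with
    | refl => exact ⟨0, 0, 0, .refl _⟩
    | head h _ ih =>
      obtain ⟨m, n, k, ih⟩ := ih
      rcases h with h | h | h
      · exact ⟨_, _, _, .step₁ h ih⟩
      · exact ⟨_, _, _, .step₂ h ih⟩
      · exact ⟨_, _, _, .step₃ h ih⟩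

theorem Counted3.prepend {a b c : α} {m n k : ℕ} (h : ReflTransGen r₃ a b)
    (hc : Counted3 r₁ r₂ r₃ m n k b c) : ∃ k', Counted3 r₁ r₂ r₃ m n k' a c := by
  induction h using ReflTransGen.head_induction_on with
  | refl => exact ⟨k, hc⟩
  | head h _ ih =>
    obtain ⟨k', ih⟩ := ih
    exact ⟨_, .step₃ h ih⟩

end Counted

theorem vSStep_eq : VSStep = fun t u => VSStepR .dB t u ∨ VSStepR .sV t u := by
  ext t u
  constructor
  · rintro ⟨_ | _, h⟩
    exacts [.inl h, .inr h]
  · rintro (h | h)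
    exacts [⟨_, h⟩, ⟨_, h⟩]

theorem sStep_eq :
    SStep = fun a b => SStepR .dB a b ∨ SStepR .sBang a b ∨ SStepR .dBang a b := by
  ext t u
  constructor
  · rintro ⟨_ | _ | _, h⟩
    exacts [.inl h, .inr (.inl h), .inr (.inr h)]
  · rintro (h | h | h)
    exacts [⟨_, h⟩, ⟨_, h⟩, ⟨_, h⟩]

theorem exists_counted3_embV {t u : LT} {m n : ℕ}
    (h : Counted2 (VStep .dB) (VStep .sV) m n t u) :
    ∃ k, Counted3 (Step .dB) (Step .sBang) (Step .dBang) m n k (embV t) (embV u) := by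
  induction h with
  | refl t => exact ⟨0, .refl _⟩
  | step₁ h _ ih =>
    obtain ⟨k, ih⟩ := ih
    obtain ⟨a, ha, hr⟩ := h.exists_step.1
    obtain ⟨k', hk⟩ := ih.prepend hr.reduces
    exact ⟨k', .step₁ ha hk⟩
  | step₂ h _ ih =>
    obtain ⟨k, ih⟩ := ih
    obtain ⟨a, ha, hr⟩ := h.exists_step.1
    obtain ⟨k', hk⟩ := ih.prepend hr.reduces
    exact ⟨k', .step₂ ha hk⟩

theorem Rep.exists_counted2 {t : LT} {a b : T} {m n k : ℕ} (ht : Rep .plain t a)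
    (h : Counted3 (Step .dB) (Step .sBang) (Step .dBang) m n k a b) :
    ∃ u, Rep .plain u b ∧ Counted2 (VStep .dB) (VStep .sV) m n t u := by
  induction h generalizing t with
  | refl a => exact ⟨t, ht, .refl _⟩
  | step₁ h _ ih =>
    obtain ⟨t', hs, hr⟩ := ht.sim h
    obtain ⟨u, hu, hc⟩ := ih hr
    exact ⟨u, hu, .step₁ hs hc⟩
  | step₂ h _ ih =>
    obtain ⟨t', hs, hr⟩ := ht.sim h
    obtain ⟨u, hu, hc⟩ := ih hr
    exact ⟨u, hu, .step₂ hs hc⟩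
  | step₃ h _ ih =>
    obtain ⟨t', rfl, hr⟩ := ht.sim h
    exact ih hr

theorem counted2_iff_counted3_embV (t u : LT) (m n : ℕ) :
    Counted2 (VStep .dB) (VStep .sV) m n t u ↔
      ∃ k, Counted3 (Step .dB) (Step .sBang) (Step .dBang) m n k (embV t) (embV u) := by
  refine ⟨exists_counted3_embV, fun ⟨k, h⟩ => ?_⟩
  obtain ⟨u', hu, hc⟩ := (rep_embV t).exists_counted2 h
  rwa [hu.unique (rep_embV u)] at hc

/-- **CBV surface preservation.**
(1) Stability: if `tᵛ →S* s'` and `s'` is a `→S,d!`-normal form, then `s' = sᵛ` for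
some CBV term `s`.
(2) Normal forms: `t` is a `→ᵛS`-normal form iff `tᵛ` is a `→S`-normal form.
(3) Simulations: `t →ᵛS* u` iff `tᵛ →S* uᵛ`; moreover corresponding sequences have the
same number of `dB`-steps, and the number of `sV`-steps on the CBV side equals the
number of `s!`-steps on the λ! side. -/
theorem cbv_surface_preservation (t u : LT) (s' : T) :
    (Relation.ReflTransGen SStep (embV t) s' → IsNF (SStepR Rule.dBang) s' →
      ∃ s : LT, embV s = s') ∧
    (IsNF VSStep t ↔ IsNF SStep (embV t)) ∧
    (Relation.ReflTransGen VSStep t u ↔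
      Relation.ReflTransGen SStep (embV t) (embV u)) ∧
    (∀ m n : ℕ, Counted2 (VSStepR VRule.dB) (VSStepR VRule.sV) m n t u ↔
      ∃ k, Counted3 (SStepR Rule.dB) (SStepR Rule.sBang) (SStepR Rule.dBang)
        m n k (embV t) (embV u)) := by
  have counted := counted2_iff_counted3_embV t u
  refine ⟨fun h hnf => ?_, ⟨fun hnf a ⟨R, h⟩ => ?_, fun hnf t' ⟨R, h⟩ => ?_⟩, ?_, ?_⟩
  · rw [sStep_eq, ← exists_counted3_iff, sStepR_eq_step] at h
    rw [sStepR_eq_step] at hnf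
    obtain ⟨m, n, k, h⟩ := h
    obtain ⟨s, hs, -⟩ := (rep_embV t).exists_counted2 h
    rcases Relation.ReflTransGen.cases_head hs.reduces with h | ⟨b, hb, -⟩
    · exact ⟨s, h.symm⟩
    · exact (hnf b hb).elim
  · rw [sStepR_iff_step] at h
    obtain ⟨t', ht, -⟩ := (rep_embV t).sim h
    cases R with
    | dB => exact hnf t' ⟨.dB, vSStepR_iff_vStep.2 ht⟩
    | sBang => exact hnf t' ⟨.sV, vSStepR_iff_vStep.2 ht⟩
    | dBang => exact (isNF_dBang_embV t).1 a h
  · obtain ⟨a, ha, -⟩ := (vSStepR_iff_vStep.1 h).exists_step.1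
    exact hnf a ⟨_, sStepR_iff_step.2 ha⟩
  · rw [vSStep_eq, sStep_eq, ← exists_counted2_iff, ← exists_counted3_iff,
      vSStepR_eq_vStep, sStepR_eq_step]
    simp only [counted]
  · rw [vSStepR_eq_vStep, sStepR_eq_step]
    exact counted

end BangPaper
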